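/- Let ρ be a density matrix on H_d ⊗ H_{B₁} ⊗ H_X ⊗ H_{B₂}. Then I(d:X|B₁)_ρ ≤ S(d|B₁)_ρ + S(d|B₂)_ρ, where S(d|Y)_ρ := S(dY)_ρ − S(Y)_ρ and I(d:X|B₁)_ρ := S(dB₁)_ρ + S(B₁X)_ρ − S(B₁)_ρ − S(dB₁X)_ρ. -/

import Mathlib

open Matrix BigOperators
open scoped ComplexOrder

/-- A density matrix: a positive semidefinite matrix of trace one. -/
def IsDensityMatrix {n : Type*} [Fintype n] (ρ : Matrix n n ℂ) : Prop :=
  ρ.PosSemidef ∧ ρ.trace = 1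

/-- The von Neumann entropy `S(ρ) = -Tr(ρ log ρ)`, computed via the eigenvalues of a
Hermitian matrix (with the convention `0 log 0 = 0`). -/
noncomputable def vNEntropy {n : Type*} [Fintype n] [DecidableEq n]
    (ρ : Matrix n n ℂ) : ℝ :=
  if h : ρ.IsHermitian then -∑ i, h.eigenvalues i * Real.log (h.eigenvalues i) else 0

/-- `A = U diag(p) Uᴴ` with `U` unitary and `p` real. -/
structure IsEigendecomposition {n : Type*} [Fintype n] [DecidableEq n]
    (A U : Matrix n n ℂ) (p : n → ℝ) : Prop where
  isometry : Uᴴ * U = 1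
  eq_conj : A = U * diagonal (fun i => (p i : ℂ)) * Uᴴ

namespace IsEigendecomposition

variable {n : Type*} [Fintype n] [DecidableEq n] {A U : Matrix n n ℂ} {p : n → ℝ}

theorem mul_conjTranspose (h : IsEigendecomposition A U p) : U * Uᴴ = 1 :=
  mul_eq_one_comm.mp h.isometry

theorem trace_eq (h : IsEigendecomposition A U p) : A.trace = ∑ i, (p i : ℂ) := by
  rw [h.eq_conj, trace_mul_cycle, h.isometry, one_mul, trace_diagonal]

theorem conj_eq (h : IsEigendecomposition A U p) :
    Uᴴ * A * U = diagonal (fun i => (p i : ℂ)) := by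
  have e : Uᴴ * A * U = (Uᴴ * U) * diagonal (fun i => (p i : ℂ)) * (Uᴴ * U) := by
    rw [h.eq_conj]; simp only [Matrix.mul_assoc]
  rw [e, h.isometry, one_mul, mul_one]

end IsEigendecomposition

theorem Matrix.IsHermitian.isEigendecomposition {n : Type*} [Fintype n] [DecidableEq n]
    {A : Matrix n n ℂ} (hA : A.IsHermitian) :
    IsEigendecomposition A (hA.eigenvectorUnitary : Matrix n n ℂ) hA.eigenvalues where
  isometry := by
    rw [← star_eq_conjTranspose]
    exact Unitary.coe_star_mul_self hA.eigenvectorUnitary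
  eq_conj := by
    conv_lhs => rw [hA.spectral_theorem]
    rfl

theorem trace_conjTranspose_mul_mul_diagonal {m n : Type*} [Fintype m] [Fintype n]
    [DecidableEq n] (Y K : Matrix m n ℂ) (p : n → ℝ) :
    (Yᴴ * K * diagonal (fun i => (p i : ℂ))).trace =
      ∑ j, ∑ i, star (Y j i) * K j i * p i := by
  simp only [trace, diag_apply, mul_diagonal]
  simp only [mul_apply, conjTranspose_apply, Finset.sum_mul]
  exact Finset.sum_comm

theorem star_mul_self_eq_norm_sq (z : ℂ) : star z * z = ((‖z‖ ^ 2 : ℝ) : ℂ) := by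
  rw [mul_comm, Complex.star_def, Complex.mul_conj, Complex.normSq_eq_norm_sq]

/-- The concave quadratic functional whose supremum over `Z` is `⟨ρ, (L_σ + t R_ρ)⁻¹ ρ⟩`. -/
noncomputable def resolventFunctional {n : Type*} [Fintype n] (ρ σ : Matrix n n ℂ) (t : ℝ)
    (Z : Matrix n n ℂ) : ℝ :=
  (2 * (Zᴴ * ρ).trace - (Z * Zᴴ * σ).trace - t * (Zᴴ * Z * ρ).trace).re

theorem resolventFunctional_eq_sum {n : Type*} [Fintype n] [DecidableEq n]
    {ρ σ U V : Matrix n n ℂ} {p q : n → ℝ} (hρ : IsEigendecomposition ρ U p)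
    (hσ : IsEigendecomposition σ V q) (t : ℝ) (Y : Matrix n n ℂ) :
    resolventFunctional ρ σ t (V * Y * Uᴴ) =
      ∑ j, ∑ i, (2 * (star (Y j i) * (Vᴴ * U) j i).re * p i -
        (q j + t * p i) * ‖Y j i‖ ^ 2) := by
  have e₁ : ((V * Y * Uᴴ)ᴴ * ρ).trace =
      ∑ j, ∑ i, star (Y j i) * (Vᴴ * U) j i * p i := by
    rw [← trace_conjTranspose_mul_mul_diagonal, ← hρ.conj_eq]
    have : (V * Y * Uᴴ)ᴴ * ρ = U * (Yᴴ * Vᴴ * ρ) := by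
      simp only [conjTranspose_mul, conjTranspose_conjTranspose, Matrix.mul_assoc]
    rw [this, trace_mul_comm]
    have : Yᴴ * (Vᴴ * U) * (Uᴴ * ρ * U) = Yᴴ * Vᴴ * (U * Uᴴ) * ρ * U := by
      simp only [Matrix.mul_assoc]
    rw [this, hρ.mul_conjTranspose, mul_one]
  have e₂ : ((V * Y * Uᴴ) * (V * Y * Uᴴ)ᴴ * σ).trace =
      ∑ j, ∑ i, (q j : ℂ) * (star (Y j i) * Y j i) := by
    have : (V * Y * Uᴴ) * (V * Y * Uᴴ)ᴴ * σ = V * (Y * (Uᴴ * U) * Yᴴ * Vᴴ * σ) := by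
      simp only [conjTranspose_mul, conjTranspose_conjTranspose, Matrix.mul_assoc]
    rw [this, trace_mul_comm, hρ.isometry, mul_one]
    have : Y * Yᴴ * Vᴴ * σ * V = Y * Yᴴ * (Vᴴ * σ * V) := by
      simp only [Matrix.mul_assoc]
    rw [this, hσ.conj_eq]
    simp only [trace, diag_apply, mul_diagonal]
    simp only [mul_apply, conjTranspose_apply, Finset.sum_mul]
    refine Finset.sum_congr rfl fun _ _ => Finset.sum_congr rfl fun _ _ => by ring
  have e₃ : ((V * Y * Uᴴ)ᴴ * (V * Y * Uᴴ) * ρ).trace =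
      ∑ j, ∑ i, star (Y j i) * Y j i * p i := by
    have : (V * Y * Uᴴ)ᴴ * (V * Y * Uᴴ) * ρ = U * (Yᴴ * (Vᴴ * V) * Y * Uᴴ * ρ) := by
      simp only [conjTranspose_mul, conjTranspose_conjTranspose, Matrix.mul_assoc]
    rw [this, trace_mul_comm, hσ.isometry, mul_one, ← trace_conjTranspose_mul_mul_diagonal,
      ← hρ.conj_eq]
    simp only [Matrix.mul_assoc]
  rw [resolventFunctional, e₁, e₂, e₃]
  simp only [Finset.mul_sum, ← Finset.sum_sub_distrib, Complex.re_sum]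
  refine Finset.sum_congr rfl fun j _ => Finset.sum_congr rfl fun i _ => ?_
  rw [star_mul_self_eq_norm_sq]
  have : 2 * (star (Y j i) * (Vᴴ * U) j i * p i) - (q j : ℂ) * ((‖Y j i‖ ^ 2 : ℝ) : ℂ)
      - t * (((‖Y j i‖ ^ 2 : ℝ) : ℂ) * p i) =
      ((2 * p i : ℝ) : ℂ) * (star (Y j i) * (Vᴴ * U) j i)
        - (((q j + t * p i) * ‖Y j i‖ ^ 2 : ℝ) : ℂ) := by
    push_cast; ring
  rw [this, Complex.sub_re, Complex.re_ofReal_mul, Complex.ofReal_re]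
  ring

theorem two_mul_re_mul_sub_le (y k : ℂ) (p : ℝ) {c : ℝ} (hc : 0 < c) :
    2 * (star y * k).re * p - c * ‖y‖ ^ 2 ≤ ‖k‖ ^ 2 * p ^ 2 / c := by
  rw [le_div_iff₀ hc, ← Complex.normSq_eq_norm_sq, ← Complex.normSq_eq_norm_sq,
    Complex.normSq_apply, Complex.normSq_apply]
  simp only [Complex.star_def, Complex.mul_re, Complex.conj_re, Complex.conj_im]
  nlinarith [sq_nonneg (c * y.re - p * k.re), sq_nonneg (c * y.im - p * k.im)]

theorem resolventFunctional_le {n : Type*} [Fintype n] [DecidableEq n]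
    {ρ σ U V : Matrix n n ℂ} {p q : n → ℝ} (hρ : IsEigendecomposition ρ U p)
    (hσ : IsEigendecomposition σ V q) (hp : ∀ i, 0 ≤ p i) (hq : ∀ j, 0 < q j)
    {t : ℝ} (ht : 0 ≤ t) (Z : Matrix n n ℂ) :
    resolventFunctional ρ σ t Z ≤
      ∑ j, ∑ i, ‖(Vᴴ * U) j i‖ ^ 2 * p i ^ 2 / (q j + t * p i) := by
  have hZ : Z = V * (Vᴴ * Z * U) * Uᴴ := by
    have : V * (Vᴴ * Z * U) * Uᴴ = (V * Vᴴ) * Z * (U * Uᴴ) := by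
      simp only [Matrix.mul_assoc]
    rw [this, hρ.mul_conjTranspose, hσ.mul_conjTranspose, one_mul, mul_one]
  rw [hZ, resolventFunctional_eq_sum hρ hσ]
  exact Finset.sum_le_sum fun j _ => Finset.sum_le_sum fun i _ =>
    two_mul_re_mul_sub_le _ _ _ (add_pos_of_pos_of_nonneg (hq j) (mul_nonneg ht (hp i)))

theorem exists_resolventFunctional_eq {n : Type*} [Fintype n] [DecidableEq n]
    {ρ σ U V : Matrix n n ℂ} {p q : n → ℝ} (hρ : IsEigendecomposition ρ U p)
    (hσ : IsEigendecomposition σ V q) (hp : ∀ i, 0 ≤ p i) (hq : ∀ j, 0 < q j)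
    {t : ℝ} (ht : 0 ≤ t) :
    ∃ Z, resolventFunctional ρ σ t Z =
      ∑ j, ∑ i, ‖(Vᴴ * U) j i‖ ^ 2 * p i ^ 2 / (q j + t * p i) := by
  refine ⟨V * (Matrix.of fun j i => ((p i / (q j + t * p i) : ℝ) : ℂ) * (Vᴴ * U) j i) * Uᴴ, ?_⟩
  rw [resolventFunctional_eq_sum hρ hσ]
  refine Finset.sum_congr rfl fun j _ => Finset.sum_congr rfl fun i _ => ?_
  have hc : 0 < q j + t * p i := add_pos_of_pos_of_nonneg (hq j) (mul_nonneg ht (hp i))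
  rw [of_apply]
  generalize (Vᴴ * U) j i = k
  rw [star_mul', Complex.star_def, Complex.conj_ofReal, mul_assoc (Complex.ofReal _),
    ← Complex.normSq_eq_conj_mul_self, Complex.re_ofReal_mul, Complex.ofReal_re, norm_mul,
    Complex.norm_real, mul_pow, Real.norm_eq_abs, sq_abs, Complex.normSq_eq_norm_sq]
  field_simp
  ring

theorem hasDerivAt_sum_mul_log_add {ι : Type*} [Fintype ι] (a : ι → ℝ) {p q : ι → ℝ}
    (hp : ∀ i, 0 ≤ p i) (hq : ∀ i, 0 < q i) {t : ℝ} (ht : 0 ≤ t) :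
    HasDerivAt (fun s => ∑ i, a i * p i * (Real.log (q i + s * p i) - Real.log (q i)))
      (∑ i, a i * p i ^ 2 / (q i + t * p i)) t := by
  refine HasDerivAt.fun_sum fun i _ => ?_
  have hc : q i + t * p i ≠ 0 :=
    (add_pos_of_pos_of_nonneg (hq i) (mul_nonneg ht (hp i))).ne'
  have h := ((((hasDerivAt_id t).mul_const (p i)).const_add (q i)).log hc).sub_const
    (Real.log (q i)) |>.const_mul (a i * p i)
  refine h.congr_deriv ?_
  simp only [id]
  ring

theorem tendsto_sum_mul_log_add {ι : Type*} [Fintype ι] (a : ι → ℝ) {p q : ι → ℝ}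
    (hp : ∀ i, 0 ≤ p i) (hq : ∀ i, 0 < q i) :
    Filter.Tendsto (fun s => ∑ i, a i * p i * (Real.log (q i + s * p i) - Real.log (q i))
        - (∑ i, a i * p i) * Real.log s) Filter.atTop
      (nhds (∑ i, a i * p i * (Real.log (p i) - Real.log (q i)))) := by
  simp only [Finset.sum_mul, ← Finset.sum_sub_distrib]
  refine tendsto_finsetSum _ fun i _ => ?_
  rcases (hp i).eq_or_lt with h0 | hpos
  · simp [← h0]
  have h1 : Filter.Tendsto (fun s : ℝ => q i * s⁻¹ + p i) Filter.atTop (nhds (p i)) := by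
    simpa using (tendsto_inv_atTop_zero.const_mul (q i)).add_const (p i)
  refine (((h1.log hpos.ne').sub_const (Real.log (q i))).const_mul (a i * p i)).congr' ?_
  filter_upwards [Filter.eventually_gt_atTop 0] with s hs
  have : q i + s * p i = s * (q i * s⁻¹ + p i) := by field_simp
  rw [this, Real.log_mul hs.ne']
  · ring
  · have := hq i; positivity

theorem sum_mul_log_sub_log_le {ι κ : Type*} [Fintype ι] [Fintype κ]
    {a p q : ι → ℝ} {b r s : κ → ℝ} (hp : ∀ i, 0 ≤ p i) (hq : ∀ i, 0 < q i)
    (hr : ∀ i, 0 ≤ r i) (hs : ∀ i, 0 < s i)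
    (hsum : ∑ i, a i * p i = ∑ k, b k * r k)
    (hle : ∀ t : ℝ, 0 ≤ t →
      ∑ i, a i * p i ^ 2 / (q i + t * p i) ≤ ∑ k, b k * r k ^ 2 / (s k + t * r k)) :
    ∑ i, a i * p i * (Real.log (p i) - Real.log (q i)) ≤
      ∑ k, b k * r k * (Real.log (r k) - Real.log (s k)) := by
  refine le_of_tendsto_of_tendsto (tendsto_sum_mul_log_add a hp hq)
    (tendsto_sum_mul_log_add b hr hs) ?_
  filter_upwards [Filter.eventually_ge_atTop 0] with T hT
  rw [hsum]
  refine sub_le_sub_right ?_ _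
  have hd := fun (t : ℝ) (ht : 0 ≤ t) =>
    (hasDerivAt_sum_mul_log_add b hr hs ht).fun_sub (hasDerivAt_sum_mul_log_add a hp hq ht)
  have hmono := monotoneOn_of_deriv_nonneg (convex_Ici (0 : ℝ))
    (fun t ht => (hd t ht).continuousAt.continuousWithinAt)
    (fun t ht => (hd t (interior_subset ht)).differentiableAt.differentiableWithinAt)
    (fun t ht => by
      rw [(hd t (interior_subset ht)).deriv]
      exact sub_nonneg.mpr (hle t (interior_subset ht)))
  simpa using hmono Set.self_mem_Ici hT hT

theorem sum_norm_sq_conjTranspose_mul_apply {n : Type*} [Fintype n] [DecidableEq n]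
    {ρ σ U V : Matrix n n ℂ} {p q : n → ℝ} (hρ : IsEigendecomposition ρ U p)
    (hσ : IsEigendecomposition σ V q) (i : n) : ∑ j, ‖(Vᴴ * U) j i‖ ^ 2 = 1 := by
  have hK : (Vᴴ * U)ᴴ * (Vᴴ * U) = 1 := by
    have : (Vᴴ * U)ᴴ * (Vᴴ * U) = Uᴴ * (V * Vᴴ) * U := by
      simp only [conjTranspose_mul, conjTranspose_conjTranspose, Matrix.mul_assoc]
    rw [this, hσ.mul_conjTranspose, mul_one, hρ.isometry]
  have := congrFun (congrFun hK i) i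
  rw [mul_apply, one_apply_eq] at this
  simp only [conjTranspose_apply, star_mul_self_eq_norm_sq] at this
  exact_mod_cast this

theorem sum_mul_log_sub_trace_eq {n : Type*} [Fintype n] [DecidableEq n]
    {ρ σ U V : Matrix n n ℂ} {p q : n → ℝ} (hρ : IsEigendecomposition ρ U p)
    (hσ : IsEigendecomposition σ V q) :
    ∑ x : n × n, ‖(Vᴴ * U) x.1 x.2‖ ^ 2 * p x.2 * (Real.log (p x.2) - Real.log (q x.1)) =
      ∑ i, p i * Real.log (p i) -
        (V * diagonal (fun j => (Real.log (q j) : ℂ)) * Vᴴ * ρ).trace.re := by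
  have htr : (V * diagonal (fun j => (Real.log (q j) : ℂ)) * Vᴴ * ρ).trace =
      ∑ j, ∑ i, ((‖(Vᴴ * U) j i‖ ^ 2 * p i * Real.log (q j) : ℝ) : ℂ) := by
    have e : V * diagonal (fun j => (Real.log (q j) : ℂ)) * Vᴴ * ρ =
        V * (diagonal (fun j => (Real.log (q j) : ℂ)) * (Vᴴ * U) *
          diagonal (fun i => (p i : ℂ)) * Uᴴ) := by
      conv_lhs => rw [hρ.eq_conj]
      simp only [Matrix.mul_assoc]
    have e' : diagonal (fun j => (Real.log (q j) : ℂ)) * (Vᴴ * U) *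
          diagonal (fun i => (p i : ℂ)) * Uᴴ * V =
        diagonal (fun j => (Real.log (q j) : ℂ)) * (Vᴴ * U) *
          diagonal (fun i => (p i : ℂ)) * (Vᴴ * U)ᴴ := by
      simp only [conjTranspose_mul, conjTranspose_conjTranspose, Matrix.mul_assoc]
    rw [e, trace_mul_comm, e']
    simp only [trace, diag_apply]
    refine Finset.sum_congr rfl fun j _ => ?_
    rw [mul_apply]
    refine Finset.sum_congr rfl fun i _ => ?_
    rw [mul_diagonal, diagonal_mul, conjTranspose_apply]
    push_cast
    rw [← Complex.ofReal_pow, ← star_mul_self_eq_norm_sq]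
    ring
  rw [htr, Fintype.sum_prod_type]
  simp only [← Complex.ofReal_sum, Complex.ofReal_re, mul_sub, Finset.sum_sub_distrib]
  congr 1
  rw [Finset.sum_comm]
  refine Finset.sum_congr rfl fun i _ => ?_
  rw [← Finset.sum_mul, ← Finset.sum_mul, sum_norm_sq_conjTranspose_mul_apply hρ hσ, one_mul]

theorem sum_norm_sq_mul_eq {n : Type*} [Fintype n] [DecidableEq n]
    {ρ σ U V : Matrix n n ℂ} {p q : n → ℝ} (hρ : IsEigendecomposition ρ U p)
    (hσ : IsEigendecomposition σ V q) :
    ∑ x : n × n, ‖(Vᴴ * U) x.1 x.2‖ ^ 2 * p x.2 = ρ.trace.re := by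
  rw [Fintype.sum_prod_type, Finset.sum_comm, hρ.trace_eq, ← Complex.ofReal_sum,
    Complex.ofReal_re]
  refine Finset.sum_congr rfl fun i _ => ?_
  dsimp only
  rw [← Finset.sum_mul, sum_norm_sq_conjTranspose_mul_apply hρ hσ, one_mul]

/-- Monotonicity of relative entropy under any map of states whose dual `Φ` preserves the
resolvent functionals. -/
theorem relativeEntropy_le {m n : Type*} [Fintype m] [DecidableEq m]
    [Fintype n] [DecidableEq n] {ρ σ U V : Matrix n n ℂ} {p q : n → ℝ}
    {ρ' σ' U' V' : Matrix m m ℂ} {p' q' : m → ℝ}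
    (hρ : IsEigendecomposition ρ U p) (hσ : IsEigendecomposition σ V q)
    (hρ' : IsEigendecomposition ρ' U' p') (hσ' : IsEigendecomposition σ' V' q')
    (hp : ∀ i, 0 ≤ p i) (hq : ∀ j, 0 < q j) (hp' : ∀ i, 0 ≤ p' i) (hq' : ∀ j, 0 < q' j)
    (htr : ρ'.trace = ρ.trace) (Φ : Matrix m m ℂ → Matrix n n ℂ)
    (hΦ : ∀ t Z, resolventFunctional ρ σ t (Φ Z) = resolventFunctional ρ' σ' t Z) :
    ∑ i, p' i * Real.log (p' i) -
        (V' * diagonal (fun j => (Real.log (q' j) : ℂ)) * V'ᴴ * ρ').trace.re ≤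
      ∑ i, p i * Real.log (p i) -
        (V * diagonal (fun j => (Real.log (q j) : ℂ)) * Vᴴ * ρ).trace.re := by
  rw [← sum_mul_log_sub_trace_eq hρ hσ, ← sum_mul_log_sub_trace_eq hρ' hσ']
  refine sum_mul_log_sub_log_le (fun x => hp' x.2) (fun x => hq' x.1) (fun x => hp x.2)
    (fun x => hq x.1) ?_ fun t ht => ?_
  · rw [sum_norm_sq_mul_eq hρ hσ, sum_norm_sq_mul_eq hρ' hσ', htr]
  · obtain ⟨Z, hZ⟩ := exists_resolventFunctional_eq hρ' hσ' hp' hq' ht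
    rw [Fintype.sum_prod_type, Fintype.sum_prod_type, ← hZ, ← hΦ]
    exact resolventFunctional_le hρ hσ hp hq ht _

open scoped Kronecker

namespace IsEigendecomposition

variable {n : Type*} [Fintype n] [DecidableEq n] {A U : Matrix n n ℂ} {p : n → ℝ}

theorem add_smul_one (h : IsEigendecomposition A U p) (ε : ℝ) :
    IsEigendecomposition (A + (ε : ℂ) • (1 : Matrix n n ℂ)) U (fun i => p i + ε) where
  isometry := h.isometry
  eq_conj := by
    have e : diagonal (fun i => ((p i + ε : ℝ) : ℂ)) =
        diagonal (fun i => (p i : ℂ)) + (ε : ℂ) • (1 : Matrix n n ℂ) := by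
      rw [smul_one_eq_diagonal, diagonal_add]
      simp
    rw [e, mul_add, add_mul, ← h.eq_conj, Matrix.mul_smul, mul_one, Matrix.smul_mul, h.mul_conjTranspose]

theorem kronecker_one (h : IsEigendecomposition A U p) (e : Type*) [Fintype e] [DecidableEq e] :
    IsEigendecomposition (A ⊗ₖ (1 : Matrix e e ℂ)) (U ⊗ₖ (1 : Matrix e e ℂ))
      (fun i => p i.1) where
  isometry := by
    rw [conjTranspose_kronecker, ← mul_kronecker_mul, h.isometry, conjTranspose_one, one_mul,
      one_kronecker_one]
  eq_conj := by
    have hd : diagonal (fun i : n × e => (p i.1 : ℂ)) =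
        diagonal (fun i => (p i : ℂ)) ⊗ₖ (1 : Matrix e e ℂ) := by
      rw [← diagonal_one, diagonal_kronecker_diagonal]
      simp
    rw [hd, conjTranspose_kronecker, ← mul_kronecker_mul, ← mul_kronecker_mul, ← h.eq_conj,
      conjTranspose_one, one_mul, one_mul]

theorem submatrix (h : IsEigendecomposition A U p) {m : Type*} [Fintype m] [DecidableEq m]
    (e : m ≃ n) :
    IsEigendecomposition (A.submatrix e e) (U.submatrix e e) (p ∘ e) where
  isometry := by
    rw [conjTranspose_submatrix, submatrix_mul_equiv, h.isometry, submatrix_one_equiv]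
  eq_conj := by
    have hd : diagonal (fun i => ((p ∘ e) i : ℂ)) =
        (diagonal fun i => (p i : ℂ)).submatrix e e := by
      rw [submatrix_diagonal_equiv]
      rfl
    rw [hd, conjTranspose_submatrix, submatrix_mul_equiv, submatrix_mul_equiv, ← h.eq_conj]

/-- Functional calculus along a decomposition. -/
theorem conj_diagonal (h : IsEigendecomposition A U p) (q : n → ℝ) :
    IsEigendecomposition (U * diagonal (fun i => (q i : ℂ)) * Uᴴ) U q :=
  ⟨h.isometry, rfl⟩

theorem trace_conj_diagonal_mul (h : IsEigendecomposition A U p) (q : n → ℝ) :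
    (U * diagonal (fun i => (q i : ℂ)) * Uᴴ * A).trace.re = ∑ i, p i * q i := by
  have : U * diagonal (fun i => (q i : ℂ)) * Uᴴ * A =
      U * (diagonal (fun i => (q i : ℂ)) * Uᴴ * A) := by
    simp only [Matrix.mul_assoc]
  rw [this, trace_mul_comm]
  have : diagonal (fun i => (q i : ℂ)) * Uᴴ * A * U =
      diagonal (fun i => (q i : ℂ)) * (Uᴴ * A * U) := by
    simp only [Matrix.mul_assoc]
  rw [this, h.conj_eq, diagonal_mul_diagonal, trace_diagonal, Complex.re_sum]
  refine Finset.sum_congr rfl fun i _ => ?_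
  rw [← Complex.ofReal_mul, Complex.ofReal_re, mul_comm]

end IsEigendecomposition

/-- Partial trace over the left tensor factor. -/
def traceLeft {a b : Type*} [Fintype a] (ρ : Matrix (a × b) (a × b) ℂ) : Matrix b b ℂ :=
  Matrix.of fun i j => ∑ k, ρ (k, i) (k, j)

/-- Partial trace over the right tensor factor. -/
def traceRight {a b : Type*} [Fintype b] (ρ : Matrix (a × b) (a × b) ℂ) : Matrix a a ℂ :=
  Matrix.of fun i j => ∑ k, ρ (i, k) (j, k)

section PartialTrace

variable {a b : Type*} [Fintype a] [Fintype b]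

theorem trace_traceLeft (ρ : Matrix (a × b) (a × b) ℂ) : (traceLeft ρ).trace = ρ.trace := by
  simp only [trace, diag_apply, traceLeft, of_apply, Fintype.sum_prod_type]
  exact Finset.sum_comm

theorem trace_one_kronecker_mul [DecidableEq a] (Z : Matrix b b ℂ)
    (ρ : Matrix (a × b) (a × b) ℂ) :
    (((1 : Matrix a a ℂ) ⊗ₖ Z) * ρ).trace = (Z * traceLeft ρ).trace := by
  have h : ∀ k i, (((1 : Matrix a a ℂ) ⊗ₖ Z) * ρ) (k, i) (k, i) =
      ∑ j, Z i j * ρ (k, j) (k, i) := fun k i => by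
    simp [mul_apply, Fintype.sum_prod_type, one_apply]
  simp only [trace, diag_apply, Fintype.sum_prod_type, h]
  simp only [mul_apply, traceLeft, of_apply, Finset.mul_sum]
  rw [Finset.sum_comm]
  exact Finset.sum_congr rfl fun i _ => Finset.sum_comm

theorem trace_kronecker_one_mul [DecidableEq b] (Z : Matrix a a ℂ)
    (ρ : Matrix (a × b) (a × b) ℂ) :
    ((Z ⊗ₖ (1 : Matrix b b ℂ)) * ρ).trace = (Z * traceRight ρ).trace := by
  have h : ∀ i k, ((Z ⊗ₖ (1 : Matrix b b ℂ)) * ρ) (i, k) (i, k) =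
      ∑ j, Z i j * ρ (j, k) (i, k) := fun i k => by
    simp [mul_apply, Fintype.sum_prod_type, one_apply]
  simp only [trace, diag_apply, Fintype.sum_prod_type, h]
  simp only [mul_apply, traceRight, of_apply, Finset.mul_sum]
  exact Finset.sum_congr rfl fun i _ => Finset.sum_comm

theorem resolventFunctional_one_kronecker [DecidableEq a] (ρ σ : Matrix (a × b) (a × b) ℂ)
    (t : ℝ) (Z : Matrix b b ℂ) :
    resolventFunctional ρ σ t ((1 : Matrix a a ℂ) ⊗ₖ Z) =
      resolventFunctional (traceLeft ρ) (traceLeft σ) t Z := by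
  simp only [resolventFunctional, conjTranspose_kronecker, conjTranspose_one,
    ← mul_kronecker_mul, one_mul, trace_one_kronecker_mul]

end PartialTrace

theorem Matrix.PosSemidef.traceLeft {a b : Type*} [Fintype a]
    {ρ : Matrix (a × b) (a × b) ℂ} (h : ρ.PosSemidef) :
    (traceLeft ρ).PosSemidef := by
  have : _root_.traceLeft ρ = ∑ k, ρ.submatrix (fun i => (k, i)) (fun i => (k, i)) := by
    ext i j
    simp [_root_.traceLeft, Matrix.sum_apply]
  rw [this]
  exact posSemidef_sum _ fun k _ => h.submatrix _

theorem Matrix.PosSemidef.traceRight {a b : Type*} [Fintype b]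
    {ρ : Matrix (a × b) (a × b) ℂ} (h : ρ.PosSemidef) :
    (traceRight ρ).PosSemidef := by
  have : _root_.traceRight ρ = ∑ k, ρ.submatrix (fun i => (i, k)) (fun i => (i, k)) := by
    ext i j
    simp [_root_.traceRight, Matrix.sum_apply]
  rw [this]
  exact posSemidef_sum _ fun k _ => h.submatrix _

theorem vNEntropy_of_isHermitian {n : Type*} [Fintype n] [DecidableEq n] {A : Matrix n n ℂ}
    (hA : A.IsHermitian) :
    vNEntropy A = -∑ i, hA.eigenvalues i * Real.log (hA.eigenvalues i) :=
  dif_pos hA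

theorem tendsto_sum_mul_log_add_const {ι : Type*} [Fintype ι] (p : ι → ℝ) (c : ℝ) :
    Filter.Tendsto (fun ε => ∑ i, p i * Real.log (p i + c * ε)) (nhdsWithin 0 (Set.Ioi 0))
      (nhds (∑ i, p i * Real.log (p i))) := by
  refine tendsto_finsetSum _ fun i _ => ?_
  rcases eq_or_ne (p i) 0 with h | h
  · simp [h]
  have : Filter.Tendsto (fun ε => p i + c * ε) (nhdsWithin 0 (Set.Ioi 0)) (nhds (p i)) := by
    have : Continuous fun ε => p i + c * ε := by fun_prop
    simpa using (this.tendsto 0).mono_left nhdsWithin_le_nhds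
  exact (this.log h).const_mul _

/-- **Strong subadditivity** of the von Neumann entropy. -/
theorem vNEntropy_strong_subadditivity {a b c : Type*} [Fintype a] [DecidableEq a] [Nonempty a]
    [Fintype b] [DecidableEq b] [Fintype c] [DecidableEq c]
    {ρ : Matrix (a × b × c) (a × b × c) ℂ} (hρ : ρ.PosSemidef) :
    vNEntropy ρ + vNEntropy (traceRight (traceLeft ρ)) ≤
      vNEntropy (traceRight (ρ.submatrix (Equiv.prodAssoc a b c) (Equiv.prodAssoc a b c))) +
        vNEntropy (traceLeft ρ) := by
  set e := Equiv.prodAssoc a b c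
  set τ := traceRight (ρ.submatrix e e) with hτdef
  have hτ : τ.PosSemidef := (hρ.submatrix e).traceRight
  have hτL : traceLeft τ = traceRight (traceLeft ρ) := by
    ext i j
    simp only [hτdef, traceLeft, traceRight, of_apply, submatrix_apply]
    exact Finset.sum_comm
  have hρL := hρ.traceLeft
  have hω := hρL.traceRight
  set ω := traceRight (traceLeft ρ) with hωdef
  rw [vNEntropy_of_isHermitian hρ.1, vNEntropy_of_isHermitian hτ.1,
    vNEntropy_of_isHermitian hρL.1, vNEntropy_of_isHermitian hω.1]
  have hcard : (0 : ℝ) < Fintype.card a := by exact_mod_cast Fintype.card_pos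
  have key : ∀ ε : ℝ, 0 < ε →
      ∑ i, hρL.1.eigenvalues i * Real.log (hρL.1.eigenvalues i) -
        ∑ i, hω.1.eigenvalues i * Real.log (hω.1.eigenvalues i + Fintype.card a * ε) ≤
      ∑ i, hρ.1.eigenvalues i * Real.log (hρ.1.eigenvalues i) -
        ∑ i, hτ.1.eigenvalues i * Real.log (hτ.1.eigenvalues i + 1 * ε) := by
    intro ε hε
    have dτ := ((hτ.1.isEigendecomposition.add_smul_one (1 * ε)).kronecker_one c).submatrix e.symm
    have dω := (hω.1.isEigendecomposition.add_smul_one (Fintype.card a * ε)).kronecker_one c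
    have hσ : traceLeft (((τ + ((1 * ε : ℝ) : ℂ) • (1 : Matrix (a × b) (a × b) ℂ)) ⊗ₖ
        (1 : Matrix c c ℂ)).submatrix e.symm e.symm) =
        (ω + ((Fintype.card a * ε : ℝ) : ℂ) • (1 : Matrix b b ℂ)) ⊗ₖ (1 : Matrix c c ℂ) := by
      rw [← hτL]
      ext i j
      simp only [traceLeft, of_apply, submatrix_apply, kroneckerMap_apply, Matrix.add_apply,
        Matrix.smul_apply, one_apply, e, Equiv.prodAssoc_symm_apply, Prod.mk.injEq, true_and]
      simp [Finset.sum_add_distrib]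
    have h := relativeEntropy_le hρ.1.isEigendecomposition dτ hρL.1.isEigendecomposition dω
      hρ.eigenvalues_nonneg
      (fun j => add_pos_of_nonneg_of_pos (hτ.eigenvalues_nonneg _) (by positivity))
      hρL.eigenvalues_nonneg
      (fun j => add_pos_of_nonneg_of_pos (hω.eigenvalues_nonneg _) (by positivity))
      (trace_traceLeft ρ) (fun Z => (1 : Matrix a a ℂ) ⊗ₖ Z)
      (fun t Z => by rw [resolventFunctional_one_kronecker, hσ])
    have lω := ((hω.1.isEigendecomposition.conj_diagonal fun i =>
      Real.log (hω.1.eigenvalues i + Fintype.card a * ε)).kronecker_one c).eq_conj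
    have lτ := (((hτ.1.isEigendecomposition.conj_diagonal fun i =>
      Real.log (hτ.1.eigenvalues i + 1 * ε)).kronecker_one c).submatrix e.symm).eq_conj
    simp only [Function.comp_apply] at h lτ
    rw [← lω, ← lτ, trace_kronecker_one_mul, ← hωdef,
      hω.1.isEigendecomposition.trace_conj_diagonal_mul] at h
    have hsub : ∀ M : Matrix ((a × b) × c) ((a × b) × c) ℂ,
        (M.submatrix e.symm e.symm * ρ).trace = (M * ρ.submatrix e e).trace := fun M => by
      have : M.submatrix e.symm e.symm * ρ = (M * ρ.submatrix e e).submatrix e.symm e.symm := by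
        rw [← submatrix_mul_equiv _ _ e.symm e.symm e.symm, submatrix_submatrix]
        simp
      rw [this]
      exact Equiv.sum_comp e.symm fun i => (M * ρ.submatrix e e) i i
    rw [hsub, trace_kronecker_one_mul, ← hτdef,
      hτ.1.isEigendecomposition.trace_conj_diagonal_mul] at h
    exact h
  have lim := le_of_tendsto_of_tendsto
    ((tendsto_sum_mul_log_add_const hω.1.eigenvalues (Fintype.card a)).const_sub
      (∑ i, hρL.1.eigenvalues i * Real.log (hρL.1.eigenvalues i)))
    ((tendsto_sum_mul_log_add_const hτ.1.eigenvalues 1).const_sub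
      (∑ i, hρ.1.eigenvalues i * Real.log (hρ.1.eigenvalues i)))
    (by filter_upwards [self_mem_nhdsWithin] with ε hε using key ε hε)
  linarith

theorem vNEntropy_eq_sum_roots_charpoly {n : Type*} [Fintype n] [DecidableEq n]
    {A : Matrix n n ℂ} (hA : A.IsHermitian) :
    vNEntropy A = -(A.charpoly.roots.map fun z => z.re * Real.log z.re).sum := by
  rw [vNEntropy_of_isHermitian hA, hA.roots_charpoly_eq_eigenvalues, Multiset.map_map]
  rfl

theorem vNEntropy_transpose {n : Type*} [Fintype n] [DecidableEq n]
    {A : Matrix n n ℂ} (hA : A.IsHermitian) : vNEntropy Aᵀ = vNEntropy A := by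
  rw [vNEntropy_eq_sum_roots_charpoly hA, vNEntropy_eq_sum_roots_charpoly hA.transpose,
    charpoly_transpose]

/-- The two reduced states of a pure state have equal entropy. -/
theorem vNEntropy_mul_conjTranspose_self {m n : Type*} [Fintype m] [DecidableEq m]
    [Fintype n] [DecidableEq n] (M : Matrix m n ℂ) :
    vNEntropy (M * Mᴴ) = vNEntropy (Mᴴ * M) := by
  rw [vNEntropy_eq_sum_roots_charpoly (isHermitian_mul_conjTranspose_self M),
    vNEntropy_eq_sum_roots_charpoly (isHermitian_conjTranspose_mul_self M)]
  have h := congrArg (fun P => (P.roots.map fun z : ℂ => z.re * Real.log z.re).sum)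
    (charpoly_mul_comm' M Mᴴ)
  have hX : ∀ k : ℕ, (Polynomial.X ^ k : Polynomial ℂ) ≠ 0 := fun k =>
    pow_ne_zero k Polynomial.X_ne_zero
  simp only [Polynomial.roots_mul (mul_ne_zero (hX _) (charpoly_monic _).ne_zero),
    Polynomial.roots_X_pow, Multiset.map_add, Multiset.sum_add, Multiset.map_nsmul,
    Multiset.map_singleton, Multiset.sum_nsmul, Multiset.sum_singleton, Complex.zero_re, zero_mul,
    smul_zero, zero_add] at h
  rw [h]

open scoped MatrixOrder in
/-- **Weak monotonicity** of the von Neumann entropy. -/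
theorem vNEntropy_weak_monotonicity {a b c : Type*} [Fintype a] [DecidableEq a] [Nonempty a]
    [Fintype b] [DecidableEq b] [Fintype c] [DecidableEq c]
    {ρ : Matrix (a × b × c) (a × b × c) ℂ} (hρ : ρ.PosSemidef) :
    vNEntropy (traceRight (traceLeft ρ)) + vNEntropy (traceLeft (traceLeft ρ)) ≤
      vNEntropy (traceRight (ρ.submatrix (Equiv.prodAssoc a b c) (Equiv.prodAssoc a b c))) +
        vNEntropy (Matrix.of fun p q : a × c => ∑ k, ρ (p.1, k, p.2) (q.1, k, q.2)) := by
  obtain ⟨B, hB⟩ := CStarAlgebra.nonneg_iff_eq_star_mul_self.mp hρ.nonneg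
  have hρB : ∀ i j, ρ i j = ∑ x, B x j * star (B x i) := fun i j => by
    rw [hB, star_eq_conjTranspose, mul_apply]
    simp only [conjTranspose_apply, mul_comm]
  let N : Matrix (a × b × (a × b × c)) c ℂ :=
    Matrix.of fun p k => star (B p.2.2 (p.1, p.2.1, k))
  let N' : Matrix (b × (a × b × c)) (a × c) ℂ :=
    Matrix.of fun p k => star (B p.2 (k.1, p.1, k.2))
  have hps := posSemidef_self_mul_conjTranspose N
  have hssa := vNEntropy_strong_subadditivity hps
  have h₁ : traceLeft (N * Nᴴ) = N' * N'ᴴ := by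
    ext i j
    simp only [traceLeft, of_apply, mul_apply, conjTranspose_apply, N, N', Fintype.sum_prod_type]
  have h₂ : traceRight (traceLeft (N * Nᴴ)) = traceRight (traceLeft ρ) := by
    ext i j
    simp only [traceLeft, traceRight, of_apply, mul_apply, conjTranspose_apply, N, hρB, star_star]
    rw [Finset.sum_comm, Finset.sum_comm (s := Finset.univ (α := c))]
    refine Finset.sum_congr rfl fun k _ => ?_
    rw [Finset.sum_comm]
    simp only [mul_comm]
  have h₃ : traceRight ((N * Nᴴ).submatrix (Equiv.prodAssoc _ _ _) (Equiv.prodAssoc _ _ _)) =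
      traceRight (ρ.submatrix (Equiv.prodAssoc a b c) (Equiv.prodAssoc a b c)) := by
    ext i j
    simp only [traceRight, of_apply, submatrix_apply, Equiv.prodAssoc_apply, mul_apply,
      conjTranspose_apply, N, hρB, star_star]
    rw [Finset.sum_comm]
    simp only [mul_comm]
  have h₄ : (Nᴴ * N)ᵀ = traceLeft (traceLeft ρ) := by
    ext i j
    simp only [traceLeft, of_apply, transpose_apply, mul_apply, conjTranspose_apply, N, hρB,
      star_star, Fintype.sum_prod_type (α₁ := a) (α₂ := b × (a × b × c)),
      Fintype.sum_prod_type (α₁ := b) (α₂ := (a × b × c))]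
    rw [Finset.sum_comm]
  have h₅ : (N'ᴴ * N')ᵀ =
      Matrix.of fun p q : a × c => ∑ k, ρ (p.1, k, p.2) (q.1, k, q.2) := by
    ext i j
    simp only [of_apply, transpose_apply, mul_apply, conjTranspose_apply, N', hρB,
      star_star, Fintype.sum_prod_type (α₁ := b) (α₂ := (a × b × c))]
  rw [h₂, h₃, h₁, vNEntropy_mul_conjTranspose_self N, vNEntropy_mul_conjTranspose_self N',
    ← vNEntropy_transpose (isHermitian_conjTranspose_mul_self N),
    ← vNEntropy_transpose (isHermitian_conjTranspose_mul_self N'), h₄, h₅] at hssa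
  linarith

/-- For any density matrix `ρ` on `H_d ⊗ H_B₁ ⊗ H_X ⊗ H_B₂`,
`I(d:X|B₁) ≤ S(d|B₁) + S(d|B₂)`, i.e.
`S(dB₁) + S(B₁X) - S(B₁) - S(dB₁X) ≤ (S(dB₁) - S(B₁)) + (S(dB₂) - S(B₂))`. -/
theorem CMI_le_sum_of_conditional_entropies
    {d B₁ X B₂ : Type*} [Fintype d] [DecidableEq d] [Fintype B₁] [DecidableEq B₁]
    [Fintype X] [DecidableEq X] [Fintype B₂] [DecidableEq B₂]
    (ρ : Matrix (d × B₁ × X × B₂) (d × B₁ × X × B₂) ℂ) (hρ : IsDensityMatrix ρ)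
    (ρdB₁ : Matrix (d × B₁) (d × B₁) ℂ)
    (hρdB₁ : ρdB₁ = Matrix.of fun p q =>
      ∑ x : X, ∑ b₂ : B₂, ρ (p.1, p.2, x, b₂) (q.1, q.2, x, b₂))
    (ρB₁X : Matrix (B₁ × X) (B₁ × X) ℂ)
    (hρB₁X : ρB₁X = Matrix.of fun p q =>
      ∑ a : d, ∑ b₂ : B₂, ρ (a, p.1, p.2, b₂) (a, q.1, q.2, b₂))
    (ρB₁ : Matrix B₁ B₁ ℂ)
    (hρB₁ : ρB₁ = Matrix.of fun b b' =>
      ∑ a : d, ∑ x : X, ∑ b₂ : B₂, ρ (a, b, x, b₂) (a, b', x, b₂))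
    (ρdB₁X : Matrix (d × B₁ × X) (d × B₁ × X) ℂ)
    (hρdB₁X : ρdB₁X = Matrix.of fun p q =>
      ∑ b₂ : B₂, ρ (p.1, p.2.1, p.2.2, b₂) (q.1, q.2.1, q.2.2, b₂))
    (ρdB₂ : Matrix (d × B₂) (d × B₂) ℂ)
    (hρdB₂ : ρdB₂ = Matrix.of fun p q =>
      ∑ b₁ : B₁, ∑ x : X, ρ (p.1, b₁, x, p.2) (q.1, b₁, x, q.2))
    (ρB₂ : Matrix B₂ B₂ ℂ)
    (hρB₂ : ρB₂ = Matrix.of fun b b' =>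
      ∑ a : d, ∑ b₁ : B₁, ∑ x : X, ρ (a, b₁, x, b) (a, b₁, x, b')) :
    vNEntropy ρdB₁ + vNEntropy ρB₁X - vNEntropy ρB₁ - vNEntropy ρdB₁X
      ≤ (vNEntropy ρdB₁ - vNEntropy ρB₁) + (vNEntropy ρdB₂ - vNEntropy ρB₂) := by
  have : Nonempty d := by
    by_contra h
    rw [not_nonempty_iff] at h
    simpa [trace] using hρ.2
  let e : d × (B₁ × X) × B₂ → d × B₁ × X × B₂ := fun p => (p.1, p.2.1.1, p.2.1.2, p.2.2)
  have h := vNEntropy_weak_monotonicity (hρ.1.submatrix e)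
  have h₁ : traceRight (traceLeft (ρ.submatrix e e)) = ρB₁X := by
    rw [hρB₁X]
    ext i j
    exact Finset.sum_comm
  have h₂ : traceLeft (traceLeft (ρ.submatrix e e)) = ρB₂ := by
    rw [hρB₂]
    ext i j
    simp only [traceLeft, of_apply, submatrix_apply, e]
    rw [Finset.sum_comm]
    simp only [Fintype.sum_prod_type]
  have h₃ : traceRight ((ρ.submatrix e e).submatrix (Equiv.prodAssoc d (B₁ × X) B₂)
      (Equiv.prodAssoc d (B₁ × X) B₂)) = ρdB₁X := by
    rw [hρdB₁X]
    rfl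
  have h₄ : (Matrix.of fun p q : d × B₂ =>
      ∑ k, ρ.submatrix e e (p.1, k, p.2) (q.1, k, q.2)) = ρdB₂ := by
    rw [hρdB₂]
    ext i j
    simp only [of_apply, submatrix_apply, e, Fintype.sum_prod_type]
  rw [h₁, h₂, h₃, h₄] at h
  linarith
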